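/- arXiv:2405.19807 — 2 statements merged into one kernel-verified Lean document; each statement's English description precedes it below -/
import Mathlib

section
/- For any two policies π and π', any transition kernel p, and all n ∈ [N]: ‖μ_n^{π,p} − μ_n^{π',p}‖₁ ≤ Σ_{i=1}^{n} Σ_{x∈𝒳} ρ_i^{π,p}(x) · ‖π_i(·|x) − π'_i(·|x)‖₁, where ρ_i^{π,p}(x) := Σ_{a∈𝒜} μ_i^{π,p}(x,a). -/
open Finset

noncomputable section

/-- L1 distance between two real-valued functions on a finite set. -/
def l1 {Y : Type*} [Fintype Y] (f g : Y → ℝ) : ℝ := ∑ y, |f y - g y|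

/-- Probability simplex on a finite set: nonnegative entries summing to 1. -/
def IsSimplex {Y : Type*} [Fintype Y] (f : Y → ℝ) : Prop :=
  (∀ y, 0 ≤ f y) ∧ ∑ y, f y = 1

/-- A policy `π n x a = π_n(a|x)` has `π_n(·|x)` in the simplex over actions. -/
def IsPolicy {X A : Type*} [Fintype A] (π : ℕ → X → A → ℝ) : Prop :=
  ∀ n x, IsSimplex (π n x)

/-- A transition kernel `p n x a x' = p_n(x'|x,a)` has `p_n(·|x,a)` in the simplex over states. -/
def IsKernel {X A : Type*} [Fintype X] (p : ℕ → X → A → X → ℝ) : Prop :=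
  ∀ n x a, IsSimplex (p n x a)

/-- The state-action distribution sequence `μ^{π,p}` induced by policy `π`. -/
def induced {X A : Type*} [Fintype X] [Fintype A] (μ0 : X × A → ℝ)
    (π : ℕ → X → A → ℝ) (p : ℕ → X → A → X → ℝ) : ℕ → X × A → ℝ
  | 0 => μ0
  | n + 1 => fun xa =>
      ∑ x' : X, ∑ a' : A, induced μ0 π p n (x', a') * p (n + 1) x' a' xa.1 * π (n + 1) xa.1 xa.2

theorem induced_nonneg_aux {X A : Type*} [Fintype X] [Fintype A]
    (μ0 : X × A → ℝ) (hμ0 : IsSimplex μ0)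
    (π : ℕ → X → A → ℝ) (hπ : IsPolicy π)
    (p : ℕ → X → A → X → ℝ) (hp : IsKernel p) (n : ℕ) :
    ∀ y, 0 ≤ induced μ0 π p n y := by
  induction n with
  | zero => exact hμ0.1
  | succ n ih =>
    intro y
    simp only [induced]
    exact Finset.sum_nonneg fun x _ => Finset.sum_nonneg fun a _ =>
      mul_nonneg (mul_nonneg (ih _) ((hp _ _ _).1 _)) ((hπ _ _).1 _)

/-- State marginal at time `n+1` obtained by pushing `μ` through the kernel. -/
def pushAux {X A : Type*} [Fintype X] [Fintype A] (μ : X × A → ℝ)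
    (k : X → A → X → ℝ) (x : X) : ℝ := ∑ x' : X, ∑ a' : A, μ (x', a') * k x' a' x

theorem induced_succ_aux {X A : Type*} [Fintype X] [Fintype A] (μ0 : X × A → ℝ)
    (π : ℕ → X → A → ℝ) (p : ℕ → X → A → X → ℝ) (n : ℕ) (x : X) (a : A) :
    induced μ0 π p (n + 1) (x, a)
      = pushAux (induced μ0 π p n) (p (n + 1)) x * π (n + 1) x a := by
  simp only [induced, pushAux, Finset.sum_mul]

theorem push_diff_aux {X A : Type*} [Fintype X] [Fintype A] (μ ν : X × A → ℝ)
    (k : X → A → X → ℝ) (hk : ∀ x a, IsSimplex (k x a)) :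
    ∑ x, |pushAux μ k x - pushAux ν k x| ≤ l1 μ ν := by
  have h1 : ∀ x, |pushAux μ k x - pushAux ν k x|
      ≤ ∑ y : X × A, |μ y - ν y| * k y.1 y.2 x := by
    intro x
    have : pushAux μ k x - pushAux ν k x = ∑ y : X × A, (μ y - ν y) * k y.1 y.2 x := by
      simp only [pushAux, Fintype.sum_prod_type, sub_mul, Finset.sum_sub_distrib]
    rw [this]
    refine (Finset.abs_sum_le_sum_abs _ _).trans (le_of_eq ?_)
    refine Finset.sum_congr rfl fun y _ => ?_
    rw [abs_mul, abs_of_nonneg ((hk _ _).1 _)]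
  refine (Finset.sum_le_sum fun x _ => h1 x).trans (le_of_eq ?_)
  rw [Finset.sum_comm]
  simp only [← Finset.mul_sum, (hk _ _).2, mul_one, l1]

/-- For any two policies `π, π'`, any transition kernel `p`, and all `n ∈ [N]`:
`‖μ_n^{π,p} − μ_n^{π',p}‖₁ ≤ Σ_{i=1}^{n} Σ_{x} ρ_i^{π,p}(x) ‖π_i(·|x) − π'_i(·|x)‖₁`,
where `ρ_i^{π,p}(x) = Σ_a μ_i^{π,p}(x,a)` is the state marginal. -/
theorem stmt3 {X A : Type*} [Fintype X] [Fintype A] [Nonempty X] [Nonempty A]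
    (N : ℕ) (μ0 : X × A → ℝ) (hμ0 : IsSimplex μ0)
    (π π' : ℕ → X → A → ℝ) (hπ : IsPolicy π) (hπ' : IsPolicy π')
    (p : ℕ → X → A → X → ℝ) (hp : IsKernel p) :
    ∀ n ≤ N,
      l1 (induced μ0 π p n) (induced μ0 π' p n)
        ≤ ∑ i ∈ Finset.Icc 1 n, ∑ x : X,
            (∑ a : A, induced μ0 π p i (x, a)) * l1 (π i x) (π' i x) := by
  intro n _
  induction n with
  | zero => simp [l1, induced]
  | succ n ih =>
    have ih := ih (by omega)
    rw [Finset.sum_Icc_succ_top (by omega)]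
    have hd := push_diff_aux (induced μ0 π p n) (induced μ0 π' p n) (p (n + 1)) (hp (n + 1))
    have hq : ∀ x, 0 ≤ pushAux (induced μ0 π p n) (p (n + 1)) x := fun x =>
      Finset.sum_nonneg fun x' _ => Finset.sum_nonneg fun a' _ =>
        mul_nonneg (induced_nonneg_aux μ0 hμ0 π hπ p hp n _) ((hp _ _ _).1 _)
    have key : l1 (induced μ0 π p (n + 1)) (induced μ0 π' p (n + 1))
        ≤ (∑ x, |pushAux (induced μ0 π p n) (p (n + 1)) x
            - pushAux (induced μ0 π' p n) (p (n + 1)) x|)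
          + ∑ x, pushAux (induced μ0 π p n) (p (n + 1)) x
              * l1 (π (n + 1) x) (π' (n + 1) x) := by
      rw [← Finset.sum_add_distrib]
      unfold l1
      rw [Fintype.sum_prod_type]
      refine Finset.sum_le_sum fun x _ => ?_
      simp only [induced_succ_aux]
      generalize pushAux (induced μ0 π' p n) (p (n + 1)) x = q'
      have hqx := hq x
      generalize pushAux (induced μ0 π p n) (p (n + 1)) x = q at hqx ⊢
      have e : |q - q'| = ∑ a, |q - q'| * π' (n + 1) x a := by
        rw [← Finset.mul_sum, (hπ' _ _).2, mul_one]
      rw [e, Finset.mul_sum, ← Finset.sum_add_distrib]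
      refine Finset.sum_le_sum fun a _ => ?_
      have e2 : q * π (n + 1) x a - q' * π' (n + 1) x a
          = (q - q') * π' (n + 1) x a + q * (π (n + 1) x a - π' (n + 1) x a) := by ring
      rw [e2]
      refine (abs_add_le _ _).trans (le_of_eq ?_)
      rw [abs_mul, abs_mul, abs_of_nonneg ((hπ' (n + 1) x).1 a), abs_of_nonneg hqx]
    have hm : ∀ x, ∑ a, induced μ0 π p (n + 1) (x, a)
        = pushAux (induced μ0 π p n) (p (n + 1)) x := by
      intro x
      simp only [induced_succ_aux]
      rw [← Finset.mul_sum, (hπ _ _).2, mul_one]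
    simp only [hm]
    linarith

end
end

section
/- (Deterministic core of the MDP-estimation regret bound.) Let I = [t_s, t_e] ⊆ [T] with |I| := t_e − t_s, let C > 0, let (p^t)_{t∈I} and (q^t)_{t∈I} be transition kernel sequences, let (π^t)_{t∈I} be an arbitrary sequence of policies, and let (F^t)_{t∈I} satisfy |F^t(μ) − F^t(ν)| ≤ L_F · Σ_{n=1}^N ‖μ_n − ν_n‖₁. Assume that for all t with t_s < t ≤ t_e, all n ∈ [N] and all (x,a): ‖p_n^t(·|x,a) − q_n^t(·|x,a)‖₁ ≤ C/sqrt(t−t_s) + Σ_{k=t_s}^{t−1} Δ_k^p, where Δ_k^p := max_{n,x,a} ‖p_n^{k+1}(·|x,a) − p_n^k(·|x,a)‖₁. Then Σ_{t=t_s+1}^{t_e} [ F^t(μ^{π^t,p^t}) − F^t(μ^{π^t,q^t}) ] ≤ L_F·N²·( 2·C·sqrt(|I|) + |I|·Δ^p_I ), where Δ^p_I := Σ_{k=t_s}^{t_e−1} Δ_k^p. -/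
open Finset

noncomputable section

/-- `Δ_k^p := max_{n ∈ [N], x, a} ‖p_n^{k+1}(·|x,a) − p_n^k(·|x,a)‖₁`. -/
def Deltap {X A : Type*} [Fintype X] [Fintype A] (p : ℕ → ℕ → X → A → X → ℝ)
    (N k : ℕ) : ℝ :=
  ⨆ i : Fin N × X × A,
    l1 (p (k + 1) ((i.1 : ℕ) + 1) i.2.1 i.2.2) (p k ((i.1 : ℕ) + 1) i.2.1 i.2.2)

theorem ind_simplex {X A : Type*} [Fintype X] [Fintype A] (μ0 : X × A → ℝ) (hμ0 : IsSimplex μ0)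
    (π : ℕ → X → A → ℝ) (p : ℕ → X → A → X → ℝ) (hπ : IsPolicy π) (hp : IsKernel p) (n : ℕ) :
    IsSimplex (induced μ0 π p n) := by
  induction n with
  | zero => exact hμ0
  | succ n ih =>
    refine ⟨fun y => ?_, ?_⟩
    · exact Finset.sum_nonneg fun x' _ => Finset.sum_nonneg fun a' _ =>
        mul_nonneg (mul_nonneg (ih.1 _) ((hp _ _ _).1 _)) ((hπ _ _).1 _)
    · simp only [induced]
      rw [Fintype.sum_prod_type]
      have h : ∀ x : X, ∑ a : A, ∑ x' : X, ∑ a' : A,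
          induced μ0 π p n (x', a') * p (n + 1) x' a' x * π (n + 1) x a
          = ∑ z : X × A, induced μ0 π p n z * p (n + 1) z.1 z.2 x := by
        intro x
        simp only [← Finset.sum_mul]
        rw [← Finset.mul_sum, (hπ (n + 1) x).2, mul_one, Fintype.sum_prod_type]
      simp only [h]
      rw [Finset.sum_comm]
      simp only [← Finset.mul_sum, (hp _ _ _).2, mul_one]
      exact ih.2

theorem ind_step {X A : Type*} [Fintype X] [Fintype A] (μ0 : X × A → ℝ) (hμ0 : IsSimplex μ0)
    (π : ℕ → X → A → ℝ) (p q : ℕ → X → A → X → ℝ) (hπ : IsPolicy π) (hp : IsKernel p)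
    (hq : IsKernel q) (n : ℕ) (e : ℝ)
    (he : ∀ x a, l1 (p (n + 1) x a) (q (n + 1) x a) ≤ e) :
    l1 (induced μ0 π p (n + 1)) (induced μ0 π q (n + 1))
      ≤ l1 (induced μ0 π p n) (induced μ0 π q n) + e := by
  have hs := ind_simplex μ0 hμ0 π p hπ hp n
  set μ := induced μ0 π p n with hμ
  set ν := induced μ0 π q n with hν
  have key : ∀ y : X × A, |induced μ0 π p (n + 1) y - induced μ0 π q (n + 1) y|
      ≤ (∑ z : X × A, (μ z * |p (n + 1) z.1 z.2 y.1 - q (n + 1) z.1 z.2 y.1|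
          + |μ z - ν z| * q (n + 1) z.1 z.2 y.1)) * π (n + 1) y.1 y.2 := by
    intro y
    have e1 : induced μ0 π p (n + 1) y - induced μ0 π q (n + 1) y
        = (∑ z : X × A, (μ z * (p (n + 1) z.1 z.2 y.1 - q (n + 1) z.1 z.2 y.1)
          + (μ z - ν z) * q (n + 1) z.1 z.2 y.1)) * π (n + 1) y.1 y.2 := by
      simp only [induced]
      rw [← hμ, ← hν, Fintype.sum_prod_type, ← Finset.sum_sub_distrib, Finset.sum_mul]
      refine Finset.sum_congr rfl fun x _ => ?_
      rw [← Finset.sum_sub_distrib, Finset.sum_mul]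
      refine Finset.sum_congr rfl fun a _ => ?_
      ring
    rw [e1, abs_mul, abs_of_nonneg ((hπ (n + 1) y.1).1 y.2)]
    refine mul_le_mul_of_nonneg_right ?_ ((hπ (n + 1) y.1).1 y.2)
    refine (Finset.abs_sum_le_sum_abs _ _).trans (Finset.sum_le_sum fun z _ => ?_)
    refine (abs_add_le _ _).trans (le_of_eq ?_)
    rw [abs_mul, abs_mul, abs_of_nonneg (hs.1 z), abs_of_nonneg ((hq (n + 1) z.1 z.2).1 y.1)]
  refine (Finset.sum_le_sum fun y _ => key y).trans ?_
  rw [Fintype.sum_prod_type]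
  simp only [← Finset.mul_sum, (hπ _ _).2, mul_one]
  rw [Finset.sum_comm]
  simp only [Finset.sum_add_distrib, ← Finset.mul_sum, (hq _ _ _).2, mul_one]
  rw [add_comm]
  refine add_le_add le_rfl ?_
  calc _ ≤ ∑ z : X × A, μ z * e :=
        Finset.sum_le_sum fun z _ => mul_le_mul_of_nonneg_left (he z.1 z.2) (hs.1 z)
    _ = e := by rw [← Finset.sum_mul, hs.2, one_mul]

theorem ind_bound {X A : Type*} [Fintype X] [Fintype A] (μ0 : X × A → ℝ) (hμ0 : IsSimplex μ0)
    (π : ℕ → X → A → ℝ) (p q : ℕ → X → A → X → ℝ) (hπ : IsPolicy π) (hp : IsKernel p)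
    (hq : IsKernel q) (N : ℕ) (e : ℝ)
    (he : ∀ n, 1 ≤ n → n ≤ N → ∀ x a, l1 (p n x a) (q n x a) ≤ e) (n : ℕ) (hn : n ≤ N) :
    l1 (induced μ0 π p n) (induced μ0 π q n) ≤ n * e := by
  induction n with
  | zero => simp [l1, induced]
  | succ n ih =>
    have := ind_step μ0 hμ0 π p q hπ hp hq n e (he (n + 1) (by omega) hn)
    have := ih (by omega)
    push_cast
    linarith

theorem sum_inv_sqrt (s m : ℕ) :
    ∑ t ∈ Finset.Icc (s + 1) (s + m), 1 / Real.sqrt ((t : ℝ) - (s : ℝ)) ≤ 2 * Real.sqrt m := by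
  induction m with
  | zero => simp
  | succ m ih =>
    rw [← add_assoc, Finset.sum_Icc_succ_top (by omega)]
    have h0 : ((s + m + 1 : ℕ) : ℝ) - s = (m : ℝ) + 1 := by push_cast; ring
    rw [h0]
    push_cast
    have ha := Real.sqrt_nonneg (m : ℝ)
    have hb : 0 < Real.sqrt ((m : ℝ) + 1) := Real.sqrt_pos.2 (by positivity)
    have ha2 := Real.sq_sqrt (Nat.cast_nonneg (α := ℝ) m)
    have hb2 := Real.sq_sqrt (show (0 : ℝ) ≤ (m : ℝ) + 1 by positivity)
    have : 1 / Real.sqrt ((m : ℝ) + 1) ≤ 2 * Real.sqrt ((m : ℝ) + 1) - 2 * Real.sqrt m := by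
      rw [div_le_iff₀ hb]
      nlinarith [sq_nonneg (Real.sqrt ((m : ℝ) + 1) - Real.sqrt m)]
    linarith

theorem Deltap_nonneg {X A : Type*} [Fintype X] [Fintype A] (p : ℕ → ℕ → X → A → X → ℝ)
    (N k : ℕ) : 0 ≤ Deltap p N k :=
  Real.iSup_nonneg fun _ => Finset.sum_nonneg fun _ _ => abs_nonneg _

/-- deterministic core of the MDP-estimation regret bound: on an interval
`I = [t_s, t_e]` with `|I| = t_e − t_s`, if each `F^t` is `L_F`-Lipschitz in the sense
`|F^t(μ) − F^t(ν)| ≤ L_F Σ_{n=1}^N ‖μ_n − ν_n‖₁`, and the kernel sequences satisfy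
`‖p_n^t(·|x,a) − q_n^t(·|x,a)‖₁ ≤ C/sqrt(t−t_s) + Σ_{k=t_s}^{t−1} Δ_k^p` for all
`t_s < t ≤ t_e`, `n ∈ [N]`, `(x,a)`, then
`Σ_{t=t_s+1}^{t_e} [F^t(μ^{π^t,p^t}) − F^t(μ^{π^t,q^t})]
  ≤ L_F N² (2 C sqrt(|I|) + |I| Δ^p_I)` with `Δ^p_I = Σ_{k=t_s}^{t_e−1} Δ_k^p`. -/
theorem stmt12 {X A : Type*} [Fintype X] [Fintype A] [Nonempty X] [Nonempty A]
    (N T : ℕ) (μ0 : X × A → ℝ) (hμ0 : IsSimplex μ0)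
    (tstart tend : ℕ) (h1 : 1 ≤ tstart) (h2 : tstart ≤ tend) (h3 : tend ≤ T)
    (C : ℝ) (hC : 0 < C) (LF : ℝ) (hLF : 0 < LF)
    (p q : ℕ → ℕ → X → A → X → ℝ)
    (hp : ∀ t, IsKernel (p t)) (hq : ∀ t, IsKernel (q t))
    (π : ℕ → ℕ → X → A → ℝ) (hπ : ∀ t, IsPolicy (π t))
    (F : ℕ → (ℕ → X × A → ℝ) → ℝ)
    (hF : ∀ t ∈ Finset.Icc tstart tend, ∀ μ ν : ℕ → X × A → ℝ,
      |F t μ - F t ν| ≤ LF * ∑ n ∈ Finset.Icc 1 N, l1 (μ n) (ν n))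
    (hclose : ∀ t, tstart < t → t ≤ tend → ∀ n, 1 ≤ n → n ≤ N → ∀ x a,
      l1 (p t n x a) (q t n x a)
        ≤ C / Real.sqrt ((t : ℝ) - (tstart : ℝ)) + ∑ k ∈ Finset.Ico tstart t, Deltap p N k) :
    ∑ t ∈ Finset.Icc (tstart + 1) tend,
        (F t (induced μ0 (π t) (p t)) - F t (induced μ0 (π t) (q t)))
      ≤ LF * (N : ℝ) ^ 2 *
          (2 * C * Real.sqrt ((tend - tstart : ℕ) : ℝ)
            + ((tend - tstart : ℕ) : ℝ) * ∑ k ∈ Finset.Ico tstart tend, Deltap p N k) := by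
  obtain ⟨m, rfl⟩ := Nat.exists_eq_add_of_le h2
  rw [Nat.add_sub_cancel_left]
  set D := ∑ k ∈ Finset.Ico tstart (tstart + m), Deltap p N k with hD
  have hterm : ∀ t ∈ Finset.Icc (tstart + 1) (tstart + m),
      F t (induced μ0 (π t) (p t)) - F t (induced μ0 (π t) (q t))
        ≤ LF * (N : ℝ) ^ 2 * (C * (1 / Real.sqrt ((t : ℝ) - (tstart : ℝ))) + D) := by
    intro t ht
    rw [Finset.mem_Icc] at ht
    set e := C * (1 / Real.sqrt ((t : ℝ) - (tstart : ℝ))) + D with he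
    have hD0 : 0 ≤ D := Finset.sum_nonneg fun k _ => Deltap_nonneg p N k
    have he0 : 0 ≤ e := by positivity
    have hle : ∀ n, 1 ≤ n → n ≤ N → ∀ x a, l1 (p t n x a) (q t n x a) ≤ e := by
      intro n hn1 hn2 x a
      refine (hclose t (by omega) ht.2 n hn1 hn2 x a).trans ?_
      rw [he, mul_one_div]
      refine add_le_add le_rfl ?_
      exact Finset.sum_le_sum_of_subset_of_nonneg (Finset.Ico_subset_Ico_right ht.2)
        fun k _ _ => Deltap_nonneg p N k
    have hsum : ∑ n ∈ Finset.Icc 1 N,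
        l1 (induced μ0 (π t) (p t) n) (induced μ0 (π t) (q t) n) ≤ (N : ℝ) * (N * e) := by
      have := Finset.sum_le_card_nsmul (Finset.Icc 1 N)
        (fun n => l1 (induced μ0 (π t) (p t) n) (induced μ0 (π t) (q t) n)) ((N : ℝ) * e) (by
          intro n hn
          rw [Finset.mem_Icc] at hn
          refine (ind_bound μ0 hμ0 (π t) (p t) (q t) (hπ t) (hp t) (hq t) N e hle n hn.2).trans ?_
          exact mul_le_mul_of_nonneg_right (by exact_mod_cast hn.2) he0)
      simpa using this
    have h := (le_abs_self _).trans (hF t (Finset.mem_Icc.2 ⟨by omega, ht.2⟩)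
      (induced μ0 (π t) (p t)) (induced μ0 (π t) (q t)))
    have h' := mul_le_mul_of_nonneg_left hsum hLF.le
    calc _ ≤ _ := h
      _ ≤ _ := h'
      _ = _ := by ring
  refine (Finset.sum_le_sum hterm).trans ?_
  rw [← Finset.mul_sum, Finset.sum_add_distrib, ← Finset.mul_sum]
  refine mul_le_mul_of_nonneg_left ?_ (by positivity)
  have hs := mul_le_mul_of_nonneg_left (sum_inv_sqrt tstart m) hC.le
  simp only [Finset.sum_const, Nat.card_Icc, nsmul_eq_mul]
  rw [show tstart + m + 1 - (tstart + 1) = m by omega]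
  linarith

end
end
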